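/- (Odd case, first class.) Let n be odd, and set r_1 = \lfloor C(n,(n-3)/2) 2^{-(n+3)/2} \rfloor, v_1 = \lfloor C(n,(n+1)/2) 2^{-(n+1)/2} \rfloor, z_1 = \lfloor (C(n,(n-1)/2) + r_1 (n+3)/2 - v_1 (n+1)/2)/2 \rfloor. Let T_1(n) be the set of monotone Boolean functions f of n variables such that: every minimal one of f lies in E^{n,(n-3)/2}, E^{n,(n-1)/2}, or E^{n,(n+1)/2}; f(x) = 1 for every x with at least (n+3)/2 ones; f has exactly r_1 minimal ones in E^{n,(n-3)/2}; f has exactly v_1 maximal zeros in E^{n,(n+1)/2}; and f takes the value 1 on exactly z_1 vectors of E^{n,(n-1)/2}. Define P(n) = C(n,(n-1)/2)^{-1} \cdot (1/2)( C(n,(n-1)/2) + C(n,(n-3)/2) 2^{-(n+3)/2} (n+3)/2 - C(n,(n+1)/2) 2^{-(n+1)/2} (n+1)/2 ) and \hat{s}_1(n) = n 2^{-n+1} [ (1/2) C(n,(n-3)/2) 2^{-(n+3)/2} + (1/2) C(n,(n-3)/2)(1 - 2^{-(n+3)/2}) P(n) + (1/2) C(n,(n+1)/2) 2^{-(n+1)/2}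 + (1/2) C(n,(n+1)/2)(1 - 2^{-(n+1)/2})(1 - P(n)) ]. Then the expected average sensitivity E[s^f] of f chosen uniformly from T_1(n) satisfies E[s^f] / \hat{s}_1(n) \to 1 as n \to \infty through odd values. -/

import Mathlib

open Finset

/-- `x` with its `j`-th coordinate set to `b`. -/
def setCoord {n : ℕ} (x : Fin n → Bool) (j : Fin n) (b : Bool) : Fin n → Bool :=
  Function.update x j b

/-- `x` with its `j`-th coordinate flipped (`x ⊕ e_j`). -/
def flipCoord {n : ℕ} (x : Fin n → Bool) (j : Fin n) : Fin n → Bool :=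
  Function.update x j (!x j)

/-- Number of ones of a Boolean vector. -/
def weight {n : ℕ} (x : Fin n → Bool) : ℕ :=
  (Finset.univ.filter fun i => x i = true).card

/-- The activity `α_j^f = 2^{-n} ∑_x (f(x^{(j,0)}) ⊕ f(x^{(j,1)}))`. -/
noncomputable def activity {n : ℕ} (f : (Fin n → Bool) → Bool) (j : Fin n) : ℝ :=
  (2 ^ n : ℝ)⁻¹ * ∑ x : Fin n → Bool,
    (if f (setCoord x j false) ≠ f (setCoord x j true) then (1 : ℝ) else 0)

/-- The sensitivity `s^f(x)` of `f` at `x`. -/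
def sensAt {n : ℕ} (f : (Fin n → Bool) → Bool) (x : Fin n → Bool) : ℕ :=
  (Finset.univ.filter fun i => f (flipCoord x i) ≠ f x).card

/-- The average sensitivity `s^f`. -/
noncomputable def avgSens {n : ℕ} (f : (Fin n → Bool) → Bool) : ℝ :=
  (2 ^ n : ℝ)⁻¹ * ∑ x : Fin n → Bool, (sensAt f x : ℝ)

/-- `x` is a minimal one of the (monotone) function `f`. -/
def MinimalOne {n : ℕ} (f : (Fin n → Bool) → Bool) (x : Fin n → Bool) : Prop :=
  f x = true ∧ ∀ y, y < x → f y = false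

/-- `x` is a maximal zero of the (monotone) function `f`. -/
def MaximalZero {n : ℕ} (f : (Fin n → Bool) → Bool) (x : Fin n → Bool) : Prop :=
  f x = false ∧ ∀ y, x < y → f y = true

/-- The expected average sensitivity of a function drawn uniformly from `T`. -/
noncomputable def expAvgSens {n : ℕ} (T : Finset ((Fin n → Bool) → Bool)) : ℝ :=
  (∑ f ∈ T, avgSens f) / T.card

/-- `r_1 = ⌊C(n,(n-3)/2) 2^{-(n+3)/2}⌋` (for odd `n`). -/
def r1 (n : ℕ) : ℕ := n.choose ((n - 3) / 2) / 2 ^ ((n + 3) / 2)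

/-- `v_1 = ⌊C(n,(n+1)/2) 2^{-(n+1)/2}⌋` (for odd `n`). -/
def v1 (n : ℕ) : ℕ := n.choose ((n + 1) / 2) / 2 ^ ((n + 1) / 2)

/-- `z_1 = ⌊(C(n,(n-1)/2) + r_1 (n+3)/2 - v_1 (n+1)/2)/2⌋` (for odd `n`). -/
def z1 (n : ℕ) : ℤ :=
  ⌊((n.choose ((n - 1) / 2) : ℚ) + (r1 n : ℚ) * (((n + 3) / 2 : ℕ) : ℚ) -
      (v1 n : ℚ) * (((n + 1) / 2 : ℕ) : ℚ)) / 2⌋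

open Classical in
/-- The first class of `typical' monotone Boolean functions for odd `n`: minimal ones only
in layers `(n-3)/2, (n-1)/2, (n+1)/2`, value `1` from layer `(n+3)/2` upward, exactly `r_1`
minimal ones in layer `(n-3)/2`, exactly `v_1` maximal zeros in layer `(n+1)/2`, and value
`1` on exactly `z_1` vertices of layer `(n-1)/2`. -/
noncomputable def typicalOdd1 (n : ℕ) : Finset ((Fin n → Bool) → Bool) :=
  Finset.univ.filter fun f =>
    Monotone f ∧
    (∀ x, MinimalOne f x →
      weight x = (n - 3) / 2 ∨ weight x = (n - 1) / 2 ∨ weight x = (n + 1) / 2) ∧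
    (∀ x, (n + 3) / 2 ≤ weight x → f x = true) ∧
    {x : Fin n → Bool | MinimalOne f x ∧ weight x = (n - 3) / 2}.ncard = r1 n ∧
    {x : Fin n → Bool | MaximalZero f x ∧ weight x = (n + 1) / 2}.ncard = v1 n ∧
    ({x : Fin n → Bool | f x = true ∧ weight x = (n - 1) / 2}.ncard : ℤ) = z1 n

/-- The probability `P(n)` that a vertex of layer `(n-1)/2` carries the value `1`. -/
noncomputable def Pprob (n : ℕ) : ℝ :=
  ((n.choose ((n - 1) / 2) : ℝ))⁻¹ *
    ((1 / 2) * ((n.choose ((n - 1) / 2) : ℝ) +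
      (n.choose ((n - 3) / 2) : ℝ) * ((2 : ℝ) ^ ((n + 3) / 2))⁻¹ * (((n : ℝ) + 3) / 2) -
      (n.choose ((n + 1) / 2) : ℝ) * ((2 : ℝ) ^ ((n + 1) / 2))⁻¹ * (((n : ℝ) + 1) / 2)))

/-- `ŝ_1(n)`, the asymptotic expected average sensitivity for the first odd class. -/
noncomputable def s1hat (n : ℕ) : ℝ :=
  (n : ℝ) * (2 : ℝ) ^ (1 - (n : ℤ)) *
    ((1 / 2) * (n.choose ((n - 3) / 2) : ℝ) * ((2 : ℝ) ^ ((n + 3) / 2))⁻¹ +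
     (1 / 2) * (n.choose ((n - 3) / 2) : ℝ) * (1 - ((2 : ℝ) ^ ((n + 3) / 2))⁻¹) * Pprob n +
     (1 / 2) * (n.choose ((n + 1) / 2) : ℝ) * ((2 : ℝ) ^ ((n + 1) / 2))⁻¹ +
     (1 / 2) * (n.choose ((n + 1) / 2) : ℝ) * (1 - ((2 : ℝ) ^ ((n + 1) / 2))⁻¹) *
       (1 - Pprob n))

lemma flipCoord_involutive {n : ℕ} (i : Fin n) :
    Function.Involutive fun x : Fin n → Bool => flipCoord x i := by
  intro x
  simp [flipCoord]

lemma weight_mono {n : ℕ} {x y : Fin n → Bool} (h : x ≤ y) : weight x ≤ weight y := by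
  refine card_le_card fun i hi => ?_
  simp only [mem_filter, mem_univ, true_and] at hi ⊢
  have := h i
  rw [hi] at this
  exact Bool.eq_true_of_true_le this

lemma eq_of_le_of_weight_le {n : ℕ} {x y : Fin n → Bool} (h : x ≤ y)
    (hw : weight y ≤ weight x) : x = y := by
  have hsub : (univ.filter fun i => x i = true) ⊆ univ.filter fun i => y i = true := by
    intro i hi
    simp only [mem_filter, mem_univ, true_and] at hi ⊢
    have := h i
    rw [hi] at this
    exact Bool.eq_true_of_true_le this
  have := eq_of_subset_of_card_le hsub hw
  funext i
  have hi := Finset.ext_iff.1 this i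
  simp only [mem_filter, mem_univ, true_and] at hi
  exact Bool.eq_iff_iff.2 hi

lemma weight_lt_of_lt {n : ℕ} {x y : Fin n → Bool} (h : x < y) : weight x < weight y := by
  by_contra hw
  exact h.ne (eq_of_le_of_weight_le h.le (not_lt.1 hw))

lemma weight_update_false {n : ℕ} {x : Fin n → Bool} {i : Fin n} (h : x i = true) :
    weight (Function.update x i false) + 1 = weight x := by
  have : (univ.filter fun j => Function.update x i false j = true)
      = (univ.filter fun j => x j = true).erase i := by
    ext j
    by_cases hj : j = i <;> simp [hj]
  unfold weight
  rw [this]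
  exact card_erase_add_one (by simpa using h)

lemma weight_compl {n : ℕ} (x : Fin n → Bool) :
    (univ.filter fun i => x i = false).card + weight x = n := by
  have := card_filter_add_card_filter_not (s := (univ : Finset (Fin n))) fun i => x i = true
  simp only [Bool.not_eq_true, card_univ, Fintype.card_fin] at this
  unfold weight
  omega

/-- Total sensitivity of a monotone function as a weighted count of its ones. -/
lemma sum_sensAt_of_monotone {n : ℕ} {f : (Fin n → Bool) → Bool} (hf : Monotone f) :
    ∑ x, (sensAt f x : ℝ)
      = 2 * ∑ x, (if f x = true then (2 * (weight x : ℝ) - n) else 0) := by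
  let g : (Fin n → Bool) → ℝ := fun x => if f x = true then 1 else 0
  let σ : Fin n → (Fin n → Bool) → ℝ := fun i x => if x i = true then 1 else -1
  have hσ : ∀ x, ∑ i, σ i x = 2 * (weight x : ℝ) - n := by
    intro x
    have h1 : ∀ i, σ i x = 2 * (if x i = true then (1 : ℝ) else 0) - 1 := by
      intro i
      simp only [σ]
      split_ifs <;> norm_num
    simp_rw [h1, sum_sub_distrib, ← mul_sum, sum_boole]
    simp [weight]
  have hflip : ∀ i x, σ i (flipCoord x i) = - σ i x := by
    intro i x
    simp only [σ, flipCoord, Function.update_self]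
    cases x i <;> simp
  have hsens : ∀ x, (sensAt f x : ℝ) = ∑ i, σ i x * (g x - g (flipCoord x i)) := by
    intro x
    simp only [sensAt, card_filter, Nat.cast_sum]
    refine sum_congr rfl fun i _ => ?_
    cases hx : x i
    · have hle : x ≤ flipCoord x i := by
        simp [flipCoord, hx, Bool.le_true]
      have := hf hle
      simp only [σ, g, hx]
      revert this
      cases f x <;> cases f (flipCoord x i) <;> simp
    · have hle : flipCoord x i ≤ x := by
        simp [flipCoord, hx]
      have := hf hle
      simp only [σ, g, hx]
      revert this
      cases f x <;> cases f (flipCoord x i) <;> simp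
  have hinv : ∀ i, ∑ x, σ i x * g (flipCoord x i) = - ∑ x, σ i x * g x := by
    intro i
    rw [← sum_neg_distrib]
    refine Fintype.sum_equiv (flipCoord_involutive i).toPerm _ _ fun x => ?_
    simp [Function.Involutive.coe_toPerm, hflip]
  calc ∑ x, (sensAt f x : ℝ) = ∑ i, ∑ x, σ i x * (g x - g (flipCoord x i)) := by
        simp_rw [hsens]
        exact sum_comm
    _ = ∑ i, 2 * ∑ x, σ i x * g x := by
        refine sum_congr rfl fun i _ => ?_
        simp_rw [mul_sub, sum_sub_distrib, hinv]
        ring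
    _ = 2 * ∑ x, g x * ∑ i, σ i x := by
        rw [← mul_sum, sum_comm]
        simp_rw [mul_sum, mul_comm]
    _ = _ := by
        simp_rw [hσ, g, ite_mul, one_mul, zero_mul]

lemma sum_weight_apply {n : ℕ} (F : ℕ → ℝ) :
    ∑ x : Fin n → Bool, F (weight x) = ∑ j ∈ range (n + 1), (n.choose j : ℝ) * F j := by
  have h := sum_powerset_apply_card F (x := (univ : Finset (Fin n)))
  simp only [powerset_univ, card_univ, Fintype.card_fin, nsmul_eq_mul] at h
  rw [← h]
  refine sum_bij' (fun x _ => univ.filter fun i => x i = true) (fun s _ i => decide (i ∈ s))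
    ?_ ?_ ?_ ?_ ?_
  · simp
  · simp
  · intro x _
    funext i
    simp
  · intro s _
    ext i
    simp
  · intro x _
    rfl

lemma sum_range_ite_telescope (T : ℕ → ℝ) (t N : ℕ) (h : t ≤ N) :
    ∑ j ∈ range N, (if t ≤ j then T j - T (j + 1) else 0) = T t - T N := by
  induction N, h using Nat.le_induction with
  | base =>
    rw [sub_self]
    refine sum_eq_zero fun j hj => if_neg ?_
    have := mem_range.1 hj
    omega
  | succ N hN ih =>
    rw [sum_range_succ, ih, if_pos hN]
    ring

/-- The vectors of weight at least `t` contribute `t * C(n, t)`. -/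
lemma sum_upper_layers {n t : ℕ} (ht : t ≤ n + 1) :
    ∑ x : Fin n → Bool, (if t ≤ weight x then (2 * (weight x : ℝ) - n) else 0)
      = t * (n.choose t : ℝ) := by
  rw [sum_weight_apply fun w => if t ≤ w then (2 * (w : ℝ) - n) else 0]
  have h := sum_range_ite_telescope (fun j => (j : ℝ) * (n.choose j : ℝ)) t (n + 1) ht
  simp only [Nat.choose_succ_self, Nat.cast_zero, mul_zero, sub_zero] at h
  rw [← h]
  refine sum_congr rfl fun j hj => ?_
  have hjn : j ≤ n := by
    have := mem_range.1 hj
    omega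
  split_ifs
  · have h2 : (n.choose (j + 1) : ℝ) * ((j : ℝ) + 1) = n.choose j * ((n : ℝ) - j) := by
      have := Nat.choose_succ_right_eq n j
      rw [← Nat.cast_sub hjn]
      exact_mod_cast this
    push_cast
    linear_combination h2
  · simp

lemma exists_layer_family {n : ℕ} (I J : Finset (Fin n)) (hIJ : Disjoint I J) (t r : ℕ)
    (hr : r ≤ (n - (I.card + J.card)).choose t) :
    ∃ A : Finset (Fin n → Bool), A.card = r ∧
      ∀ a ∈ A, weight a = t + I.card ∧ (∀ i ∈ I, a i = true) ∧ ∀ i ∈ J, a i = false := by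
  classical
  let S := powersetCard t (univ \ (I ∪ J))
  let e : Finset (Fin n) → (Fin n → Bool) := fun s i => decide (i ∈ s ∪ I)
  have hS : S.card = (n - (I.card + J.card)).choose t := by
    simp only [S, card_powersetCard]
    rw [card_sdiff_of_subset (subset_univ _), card_union_of_disjoint hIJ, card_univ,
      Fintype.card_fin]
  have hdisj : ∀ s ∈ S, Disjoint s (I ∪ J) := fun s hs =>
    (subset_sdiff.1 (mem_powersetCard.1 hs).1).2
  have hinj : Set.InjOn e S := by
    intro s hs s' hs' h
    have hd := hdisj s hs
    have hd' := hdisj s' hs'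
    rw [disjoint_union_right] at hd hd'
    have hu : s ∪ I = s' ∪ I := by
      ext i
      exact decide_eq_decide.1 (congrFun h i)
    rw [← union_sdiff_cancel_right hd.1, hu, union_sdiff_cancel_right hd'.1]
  obtain ⟨A, hA, hAr⟩ := exists_subset_card_eq (s := S.image e) (n := r)
    (by rw [card_image_of_injOn hinj, hS]; exact hr)
  refine ⟨A, hAr, fun a ha => ?_⟩
  obtain ⟨s, hs, rfl⟩ := mem_image.1 (hA ha)
  have hd := hdisj s hs
  rw [disjoint_union_right] at hd
  refine ⟨?_, ?_, ?_⟩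
  · have : (univ.filter fun i => e s i = true) = s ∪ I := by
      ext i
      simp [e]
    rw [weight, this, card_union_of_disjoint hd.1, (mem_powersetCard.1 hs).2]
  · intro i hi
    simp [e, hi]
  · intro i hi
    have h1 := disjoint_right.1 hd.2 hi
    have h2 := disjoint_right.1 hIJ hi
    simp [e, h1, h2]

open Classical in
lemma card_upper_neighbors_le {n : ℕ} (A : Finset (Fin n → Bool)) (k d : ℕ)
    (hd : n ≤ d + k) (hA : ∀ a ∈ A, weight a = k) :
    (univ.filter fun y : Fin n → Bool => weight y = k + 1 ∧ ∃ a ∈ A, a ≤ y).card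
      ≤ A.card * d := by
  refine (card_le_card (t := A.biUnion fun a =>
    (univ.filter fun i => a i = false).image fun i => Function.update a i true) ?_).trans
    (card_biUnion_le_card_mul _ _ _ fun a ha => ?_)
  · intro y hy
    obtain ⟨hw, a, ha, hay⟩ := (mem_filter.1 hy).2
    have hne : ∃ i, a i = false ∧ y i = true := by
      by_contra! hcon
      have : y ≤ a := fun i => by
        cases h : a i
        · have := hcon i h
          simp [this]
        · exact Bool.le_true _
      have := weight_mono this
      have := hA a ha
      omega
    obtain ⟨i, hai, hyi⟩ := hne
    refine mem_biUnion.2 ⟨a, ha, mem_image.2 ⟨i, by simpa using hai, ?_⟩⟩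
    refine eq_of_le_of_weight_le ?_ ?_
    · intro j
      by_cases hj : j = i
      · subst hj
        simp [hyi]
      · simpa [hj] using hay j
    · have := weight_update_false (x := Function.update a i true) (i := i) (by simp)
      rw [Function.update_idem, ← hai, Function.update_eq_self] at this
      have := hA a ha
      omega
  · refine card_image_le.trans ?_
    have := weight_compl a
    have := hA a ha
    omega

open Classical in
lemma card_lower_neighbors_le {n : ℕ} (B : Finset (Fin n → Bool)) (k : ℕ)
    (hB : ∀ b ∈ B, weight b = k + 1) :
    (univ.filter fun y : Fin n → Bool => weight y = k ∧ ∃ b ∈ B, y ≤ b).card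
      ≤ B.card * (k + 1) := by
  refine (card_le_card (t := B.biUnion fun b =>
    (univ.filter fun i => b i = true).image fun i => Function.update b i false) ?_).trans
    (card_biUnion_le_card_mul _ _ _ fun b hb => ?_)
  · intro y hy
    obtain ⟨hw, b, hb, hyb⟩ := (mem_filter.1 hy).2
    have hne : ∃ i, b i = true ∧ y i = false := by
      by_contra! hcon
      have : b ≤ y := fun i => by
        cases h : b i
        · exact Bool.false_le _
        · have := hcon i h
          simp [this]
      have := weight_mono this
      have := hB b hb
      omega
    obtain ⟨i, hbi, hyi⟩ := hne
    refine mem_biUnion.2 ⟨b, hb, mem_image.2 ⟨i, by simpa using hbi, ?_⟩⟩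
    refine (eq_of_le_of_weight_le ?_ ?_).symm
    · intro j
      by_cases hj : j = i
      · subst hj
        simp [hyi]
      · simpa [hj] using hyb j
    · have := weight_update_false hbi
      have := hB b hb
      omega
  · refine card_image_le.trans ?_
    exact (hB b hb).le

lemma exists_minimalOne_le {n : ℕ} {f : (Fin n → Bool) → Bool} {x : Fin n → Bool}
    (h : f x = true) : ∃ y ≤ x, MinimalOne f y := by
  classical
  obtain ⟨y, hyx, hy⟩ := exists_le_minimal (univ.filter fun z => f z = true)
    (a := x) (by simpa using h)
  refine ⟨y, hyx, by simpa using hy.prop, fun z hz => ?_⟩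
  by_contra hfz
  exact hy.not_prop_of_lt hz (by simpa using hfz)

lemma r1_eq (k : ℕ) : r1 (2 * k + 3) = (2 * k + 3).choose k / 2 ^ (k + 3) := by
  unfold r1
  rw [show (2 * k + 3 - 3) / 2 = k by omega, show (2 * k + 3 + 3) / 2 = k + 3 by omega]

lemma v1_eq (k : ℕ) : v1 (2 * k + 3) = (2 * k + 3).choose (k + 1) / 2 ^ (k + 2) := by
  unfold v1
  rw [show (2 * k + 3 + 1) / 2 = k + 2 by omega,
    Nat.choose_symm_of_eq_add (show 2 * k + 3 = (k + 2) + (k + 1) by omega)]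

lemma choose_le_central (k : ℕ) : (2 * k + 3).choose k ≤ (2 * k + 3).choose (k + 1) :=
  Nat.choose_le_succ_of_lt_half_left (by omega)

lemma two_mul_le_two_pow (j : ℕ) : 2 * (j + 1) ≤ 2 ^ (j + 1) := by
  have : j + 1 ≤ 2 ^ j := Nat.lt_two_pow_self
  rw [pow_succ]
  omega

lemma shadows_le_layer (k : ℕ) :
    r1 (2 * k + 3) * (k + 3) + v1 (2 * k + 3) * (k + 2) ≤ (2 * k + 3).choose (k + 1) := by
  have hr : r1 (2 * k + 3) * 2 ^ (k + 3) ≤ (2 * k + 3).choose (k + 1) := by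
    rw [r1_eq]
    exact (Nat.div_mul_le_self _ _).trans (choose_le_central k)
  have hv : v1 (2 * k + 3) * 2 ^ (k + 2) ≤ (2 * k + 3).choose (k + 1) := by
    rw [v1_eq]
    exact Nat.div_mul_le_self _ _
  have h1 := Nat.mul_le_mul_left (r1 (2 * k + 3)) (two_mul_le_two_pow (k + 2))
  have h2 := Nat.mul_le_mul_left (v1 (2 * k + 3)) (two_mul_le_two_pow (k + 1))
  have e1 : r1 (2 * k + 3) * (2 * (k + 2 + 1)) = 2 * (r1 (2 * k + 3) * (k + 3)) := by ring
  have e2 : v1 (2 * k + 3) * (2 * (k + 1 + 1)) = 2 * (v1 (2 * k + 3) * (k + 2)) := by ring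
  rw [e1, show k + 2 + 1 = k + 3 from rfl] at h1
  rw [e2, show k + 1 + 1 = k + 2 from rfl] at h2
  omega

lemma z1_bounds (k : ℕ) :
    ((r1 (2 * k + 3) * (k + 3) : ℕ) : ℤ) ≤ z1 (2 * k + 3) ∧
      z1 (2 * k + 3) + ((v1 (2 * k + 3) * (k + 2) : ℕ) : ℤ) ≤ (2 * k + 3).choose (k + 1) := by
  have h : ((r1 (2 * k + 3) * (k + 3) + v1 (2 * k + 3) * (k + 2) : ℕ) : ℚ)
      ≤ ((2 * k + 3).choose (k + 1) : ℕ) := Nat.cast_le.2 (shadows_le_layer k)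
  unfold z1
  rw [show (2 * k + 3 - 1) / 2 = k + 1 by omega, show (2 * k + 3 + 3) / 2 = k + 3 by omega,
    show (2 * k + 3 + 1) / 2 = k + 2 by omega]
  push_cast at h
  constructor
  · rw [Int.le_floor]
    push_cast
    linarith
  · rw [← le_sub_iff_add_le, ← Int.cast_le (R := ℚ)]
    refine (Int.floor_le _).trans ?_
    push_cast
    linarith

lemma r1_le_choose (k : ℕ) : r1 (2 * (k + 1) + 3) ≤ (2 * (k + 1) + 2).choose k := by
  rw [r1_eq]
  have h := Nat.add_one_mul_choose_eq (2 * (k + 1) + 2) k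
  refine Nat.div_le_of_le_mul ?_
  have h5 : (2 * (k + 1) + 3).choose (k + 1) ≤ 5 * (2 * (k + 1) + 2).choose k := by
    refine Nat.le_of_mul_le_mul_right (c := k + 1) ?_ k.succ_pos
    rw [← h]
    nlinarith [Nat.zero_le ((2 * (k + 1) + 2).choose k)]
  refine h5.trans (Nat.mul_le_mul_right _ ?_)
  calc 5 ≤ 2 ^ 3 := by norm_num
    _ ≤ 2 ^ (k + 1 + 3) := Nat.pow_le_pow_right (by norm_num) (by omega)

lemma v1_le_choose (k : ℕ) : v1 (2 * k + 3) ≤ (2 * k + 1).choose (k + 1) := by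
  rw [v1_eq]
  have h1 : (2 * k + 3).choose (k + 1) = (2 * k + 2).choose k + (2 * k + 2).choose (k + 1) :=
    Nat.choose_succ_succ _ _
  have h2 : (2 * k + 2).choose (k + 1) = (2 * k + 1).choose k + (2 * k + 1).choose (k + 1) :=
    Nat.choose_succ_succ _ _
  have h3 : (2 * k + 1).choose k = (2 * k + 1).choose (k + 1) :=
    Nat.choose_symm_of_eq_add (by omega)
  have h4 : (2 * k + 2).choose k ≤ (2 * k + 2).choose (k + 1) :=
    Nat.choose_le_succ_of_lt_half_left (by omega)
  refine Nat.div_le_of_le_mul ?_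
  have h5 : 4 ≤ 2 ^ (k + 2) := by
    calc 4 = 2 ^ 2 := by norm_num
      _ ≤ 2 ^ (k + 2) := Nat.pow_le_pow_right (by norm_num) (by omega)
  have := Nat.mul_le_mul_right ((2 * k + 1).choose (k + 1)) h5
  omega

lemma mem_typicalOdd1 (k : ℕ) (f : (Fin (2 * k + 3) → Bool) → Bool) :
    f ∈ typicalOdd1 (2 * k + 3) ↔ Monotone f ∧
      (∀ x, MinimalOne f x → weight x = k ∨ weight x = k + 1 ∨ weight x = k + 2) ∧
      (∀ x, k + 3 ≤ weight x → f x = true) ∧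
      {x | MinimalOne f x ∧ weight x = k}.ncard = r1 (2 * k + 3) ∧
      {x | MaximalZero f x ∧ weight x = k + 2}.ncard = v1 (2 * k + 3) ∧
      ({x | f x = true ∧ weight x = k + 1}.ncard : ℤ) = z1 (2 * k + 3) := by
  unfold typicalOdd1
  rw [show (2 * k + 3 - 3) / 2 = k by omega, show (2 * k + 3 - 1) / 2 = k + 1 by omega,
    show (2 * k + 3 + 3) / 2 = k + 3 by omega, show (2 * k + 3 + 1) / 2 = k + 2 by omega]
  simp

lemma card_layer (n j : ℕ) :
    (univ.filter fun x : Fin n → Bool => weight x = j).card = n.choose j := by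
  have h := sum_weight_apply (n := n) fun w => if w = j then (1 : ℝ) else 0
  have h' : ((univ.filter fun x : Fin n → Bool => weight x = j).card : ℝ) = n.choose j := by
    rw [card_filter]
    push_cast
    rw [h]
    by_cases hj : j < n + 1
    · simp [hj]
    · simp [hj, Nat.choose_eq_zero_of_lt (show n < j by omega)]
  exact_mod_cast h'

lemma typicalOdd1_nonempty (k : ℕ) : (typicalOdd1 (2 * (k + 1) + 3)).Nonempty := by
  classical
  obtain ⟨A, hAr, hA⟩ := exists_layer_family (n := 2 * (k + 1) + 3) {0} ∅ (by simp) k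
    (r1 (2 * (k + 1) + 3)) (by simpa using r1_le_choose k)
  obtain ⟨B, hBv, hB⟩ := exists_layer_family (n := 2 * (k + 1) + 3) {1} {0} (by simp) (k + 2)
    (v1 (2 * (k + 1) + 3)) (by simpa using v1_le_choose (k + 1))
  simp only [card_singleton, mem_singleton, forall_eq, notMem_empty, false_imp_iff,
    implies_true, and_true] at hA hB
  generalize hm : k + 1 = m at *
  have hAB : ∀ a ∈ A, ∀ b ∈ B, ¬ a ≤ b := by
    intro a ha b hb hab
    have := hab 0
    rw [(hA a ha).2, (hB b hb).2.2] at this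
    exact Bool.false_ne_true (Bool.eq_true_of_true_le this)
  have hAw : ∀ a ∈ A, weight a = m := fun a ha => (hA a ha).1
  have hBw : ∀ b ∈ B, weight b = m + 2 := fun b hb => by
    have := (hB b hb).1
    omega
  set U := univ.filter fun y : Fin (2 * m + 3) → Bool => weight y = m + 1 ∧ ∃ a ∈ A, a ≤ y
    with hU
  set L := univ.filter fun y : Fin (2 * m + 3) → Bool => weight y = m + 1 ∧ ∃ b ∈ B, y ≤ b
    with hL
  set M := univ.filter fun y : Fin (2 * m + 3) → Bool => weight y = m + 1 with hM
  have hUc : U.card ≤ r1 (2 * m + 3) * (m + 3) := by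
    rw [← hAr]
    exact card_upper_neighbors_le A m (m + 3) (by omega) hAw
  have hLc : L.card ≤ v1 (2 * m + 3) * (m + 2) := by
    rw [← hBv]
    exact card_lower_neighbors_le B (m + 1) hBw
  have hMc : M.card = (2 * m + 3).choose (m + 1) := card_layer _ _
  obtain ⟨hz1, hz2⟩ := z1_bounds m
  obtain ⟨z, hz⟩ := Int.eq_ofNat_of_zero_le ((Int.natCast_nonneg _).trans hz1)
  rw [hz] at hz1 hz2
  have hLM : L ⊆ M := fun y hy => by
    simp only [hL, hM, mem_filter] at hy ⊢
    exact ⟨hy.1, hy.2.1⟩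
  have hUML : U ⊆ M \ L := fun y hy => by
    simp only [hU, hL, hM, mem_sdiff, mem_filter, mem_univ, true_and] at hy ⊢
    refine ⟨hy.1, fun ⟨_, b, hb, hyb⟩ => ?_⟩
    obtain ⟨a, ha, hay⟩ := hy.2
    exact hAB a ha b hb (hay.trans hyb)
  obtain ⟨Z, hUZ, hZM, hZc⟩ := exists_subsuperset_card_eq hUML (n := z)
    (by omega) (by rw [card_sdiff_of_subset hLM]; omega)
  have hZw : ∀ x ∈ Z, weight x = m + 1 := fun x hx => by
    have := hZM hx
    simp only [hM, mem_sdiff, mem_filter] at this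
    exact this.1.2
  have hZB : ∀ x ∈ Z, ∀ b ∈ B, ¬ x ≤ b := fun x hx b hb hxb => by
    have h1 := hZM hx
    rw [mem_sdiff] at h1
    exact h1.2 (by
      rw [hL, mem_filter]
      exact ⟨mem_univ _, hZw x hx, b, hb, hxb⟩)
  let f : (Fin (2 * m + 3) → Bool) → Bool := fun x =>
    decide (m + 3 ≤ weight x ∨ (weight x = m + 2 ∧ x ∉ B) ∨ x ∈ Z ∨ x ∈ A)
  have hf : ∀ x, f x = true ↔
      (m + 3 ≤ weight x ∨ (weight x = m + 2 ∧ x ∉ B) ∨ x ∈ Z ∨ x ∈ A) := fun x => by simp [f]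
  have hmono : Monotone f := by
    intro x y hxy
    rw [Bool.le_iff_imp, hf, hf]
    intro hx
    have hw := weight_mono hxy
    by_cases hwe : weight y ≤ weight x
    · rwa [← eq_of_le_of_weight_le hxy hwe]
    · rcases hx with hx | ⟨hx, -⟩ | hx | hx
      · left
        omega
      · left
        omega
      · have := hZw x hx
        by_cases hy : weight y = m + 2
        · exact Or.inr (Or.inl ⟨hy, fun hyB => hZB x hx y hyB hxy⟩)
        · left
          omega
      · have := hAw x hx
        by_cases hy : weight y = m + 2
        · exact Or.inr (Or.inl ⟨hy, fun hyB => hAB x hx y hyB hxy⟩)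
        · by_cases hy' : weight y = m + 1
          · refine Or.inr (Or.inr (Or.inl (hUZ ?_)))
            rw [hU, mem_filter]
            exact ⟨mem_univ _, hy', x, hx, hxy⟩
          · left
            omega
  refine ⟨f, (mem_typicalOdd1 m f).2 ⟨hmono, ?_, ?_, ?_, ?_, ?_⟩⟩
  · intro x hx
    rcases (hf x).1 hx.1 with h | h | h | h
    · exfalso
      obtain ⟨i, hi, hi1⟩ : ∃ i, x i = true ∧ (x 1 = true → i = 1) := by
        by_cases h1 : x 1 = true
        · exact ⟨1, h1, fun _ => rfl⟩
        · have hpos : 0 < weight x := by omega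
          obtain ⟨i, hi⟩ := card_pos.1 hpos
          exact ⟨i, by simpa using hi, fun h => absurd h h1⟩
      have hw := weight_update_false hi
      have hlt : Function.update x i false < x := by
        refine lt_of_le_of_ne ?_ fun he => ?_
        · simp [hi]
        · rw [he] at hw
          omega
      have hy1 : Function.update x i false 1 = false := by
        by_cases h1 : x 1 = true
        · simp [hi1 h1]
        · by_cases hi2 : (1 : Fin (2 * m + 3)) = i
          · simp [hi2]
          · rw [Function.update_of_ne hi2]
            simpa using h1
      have hyB : Function.update x i false ∉ B := fun hb => by
        have := (hB _ hb).2.1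
        rw [hy1] at this
        exact absurd this (by decide)
      have hy := hx.2 _ hlt
      rw [← Bool.not_eq_true, hf] at hy
      refine hy ?_
      by_cases hw3 : m + 3 ≤ weight (Function.update x i false)
      · exact Or.inl hw3
      · exact Or.inr (Or.inl ⟨by omega, hyB⟩)
    · exact Or.inr (Or.inr h.1)
    · exact Or.inr (Or.inl (hZw x h))
    · exact Or.inl (hAw x h)
  · intro x hx
    exact (hf x).2 (Or.inl hx)
  · rw [← hAr, ← Set.ncard_coe_finset]
    congr 1
    ext x
    simp only [Set.mem_ofPred_eq, mem_coe]
    constructor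
    · rintro ⟨hx, hw⟩
      rcases (hf x).1 hx.1 with h | h | h | h
      · omega
      · omega
      · have := hZw x h
        omega
      · exact h
    · intro hx
      refine ⟨⟨(hf x).2 (by tauto), fun y hy => ?_⟩, hAw x hx⟩
      have hlt := weight_lt_of_lt hy
      have hxw := hAw x hx
      rw [← Bool.not_eq_true, hf]
      rintro (h | h | h | h)
      · omega
      · omega
      · have := hZw y h
        omega
      · have := hAw y h
        omega
  · rw [← hBv, ← Set.ncard_coe_finset]
    congr 1
    ext x
    simp only [Set.mem_ofPred_eq, mem_coe]
    constructor
    · rintro ⟨hx, hw⟩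
      have h := hx.1
      rw [← Bool.not_eq_true, hf] at h
      tauto
    · intro hx
      have hxw := hBw x hx
      refine ⟨⟨?_, fun y hy => ?_⟩, hxw⟩
      · rw [← Bool.not_eq_true, hf]
        rintro (h | h | h | h)
        · omega
        · exact h.2 hx
        · have := hZw x h
          omega
        · have := hAw x h
          omega
      · have hlt := weight_lt_of_lt hy
        exact (hf y).2 (Or.inl (by omega))
  · rw [hz, ← hZc, ← Set.ncard_coe_finset]
    congr 2
    ext x
    simp only [Set.mem_ofPred_eq, mem_coe]
    constructor
    · rintro ⟨hx, hw⟩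
      rcases (hf x).1 hx with h | h | h | h
      · omega
      · omega
      · exact h
      · have := hAw x h
        omega
    · intro hx
      exact ⟨(hf x).2 (by tauto), hZw x hx⟩

lemma sum_ite_eq_ncard {α : Type*} [Fintype α] (p : α → Prop) [DecidablePred p] :
    ∑ x, (if p x then (1 : ℝ) else 0) = ({x | p x}.ncard : ℝ) := by
  rw [sum_boole, Set.ncard_eq_toFinset_card', Set.toFinset_ofPred]

/-- The average sensitivity is constant on the class. -/
lemma avgSens_of_mem_typicalOdd1 {k : ℕ} {f : (Fin (2 * k + 3) → Bool) → Bool}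
    (hf : f ∈ typicalOdd1 (2 * k + 3)) :
    avgSens f = (2 ^ (2 * k + 3) : ℝ)⁻¹ * (2 * ((k + 2) * ((2 * k + 3).choose (k + 1) : ℝ)
      - (z1 (2 * k + 3) + 3 * r1 (2 * k + 3) + v1 (2 * k + 3)))) := by
  obtain ⟨hmono, hmin, hup, hr, hv, hz⟩ := (mem_typicalOdd1 k f).1 hf
  have hlow : ∀ x, f x = true → k ≤ weight x := by
    intro x hx
    obtain ⟨y, hyx, hy⟩ := exists_minimalOne_le hx
    have := weight_mono hyx
    rcases hmin y hy with h | h | h <;> omega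
  have hr' : {x | f x = true ∧ weight x = k}.ncard = r1 (2 * k + 3) := by
    rw [← hr]
    congr 1
    ext x
    refine ⟨fun ⟨hx, hw⟩ => ⟨⟨hx, fun y hy => ?_⟩, hw⟩, fun ⟨hx, hw⟩ => ⟨hx.1, hw⟩⟩
    have hlt := weight_lt_of_lt hy
    by_contra hfy
    have := hlow y (by simpa using hfy)
    omega
  have hv' : {x | f x = false ∧ weight x = k + 2}.ncard = v1 (2 * k + 3) := by
    rw [← hv]
    congr 1
    ext x
    refine ⟨fun ⟨hx, hw⟩ => ⟨⟨hx, fun y hy => ?_⟩, hw⟩, fun ⟨hx, hw⟩ => ⟨hx.1, hw⟩⟩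
    have hlt := weight_lt_of_lt hy
    exact hup y (by omega)
  have hz' : ({x | f x = true ∧ weight x = k + 1}.ncard : ℝ) = z1 (2 * k + 3) := by
    exact_mod_cast hz
  have hpt : ∀ x, (if f x = true then (2 * (weight x : ℝ) - (2 * k + 3 : ℕ)) else 0)
      = (if k + 2 ≤ weight x then (2 * (weight x : ℝ) - (2 * k + 3 : ℕ)) else 0)
        - 3 * (if f x = true ∧ weight x = k then (1 : ℝ) else 0)
        - (if f x = true ∧ weight x = k + 1 then (1 : ℝ) else 0)
        - (if f x = false ∧ weight x = k + 2 then (1 : ℝ) else 0) := by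
    intro x
    cases hx : f x
    · by_cases h2 : k + 2 ≤ weight x
      · have h3 : weight x = k + 2 := by
          by_contra hne
          have := hup x (by omega)
          rw [hx] at this
          exact absurd this (by decide)
        simp [h3]
        ring
      · have h3 : weight x ≠ k + 2 := by omega
        simp [h2, h3]
    · have hk := hlow x hx
      by_cases h2 : k + 2 ≤ weight x
      · have h3 : weight x ≠ k := by omega
        have h4 : weight x ≠ k + 1 := by omega
        simp [h2, h3, h4]
      · by_cases h3 : weight x = k
        · simp [h3]
        · have h4 : weight x = k + 1 := by omega
          simp [h4]
          ring
  unfold avgSens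
  rw [sum_sensAt_of_monotone hmono]
  simp_rw [hpt, sum_sub_distrib, ← mul_sum]
  rw [sum_upper_layers (by omega), sum_ite_eq_ncard, sum_ite_eq_ncard, sum_ite_eq_ncard,
    hr', hv', hz', Nat.choose_symm_of_eq_add (show 2 * k + 3 = (k + 2) + (k + 1) by omega)]
  push_cast
  ring

lemma expAvgSens_typicalOdd1 (k : ℕ) (hk : 1 ≤ k) :
    expAvgSens (typicalOdd1 (2 * k + 3)) = (2 ^ (2 * k + 3) : ℝ)⁻¹ *
      (2 * ((k + 2) * ((2 * k + 3).choose (k + 1) : ℝ)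
        - (z1 (2 * k + 3) + 3 * r1 (2 * k + 3) + v1 (2 * k + 3)))) := by
  have hne : (typicalOdd1 (2 * k + 3)).Nonempty := by
    obtain ⟨j, rfl⟩ := Nat.exists_eq_add_of_le' hk
    exact typicalOdd1_nonempty j
  have hc : ((typicalOdd1 (2 * k + 3)).card : ℝ) ≠ 0 := by
    exact_mod_cast hne.card_pos.ne'
  unfold expAvgSens
  rw [sum_congr rfl fun f hf => avgSens_of_mem_typicalOdd1 hf, sum_const, nsmul_eq_mul,
    mul_div_cancel_left₀ _ hc]

/-- The corrections to the central layer are of the order of that layer. -/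
lemma correction_bounds (k : ℕ) :
    0 ≤ (z1 (2 * k + 3) + 3 * r1 (2 * k + 3) + v1 (2 * k + 3) : ℝ) ∧
      (z1 (2 * k + 3) + 3 * r1 (2 * k + 3) + v1 (2 * k + 3) : ℝ)
        ≤ 5 * ((2 * k + 3).choose (k + 1) : ℝ) := by
  obtain ⟨h1, h2⟩ := z1_bounds k
  have hr : r1 (2 * k + 3) ≤ (2 * k + 3).choose (k + 1) := by
    rw [r1_eq]
    exact (Nat.div_le_self _ _).trans (choose_le_central k)
  have hv : v1 (2 * k + 3) ≤ (2 * k + 3).choose (k + 1) := by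
    rw [v1_eq]
    exact Nat.div_le_self _ _
  have h0 : (0 : ℤ) ≤ z1 (2 * k + 3) := (Int.natCast_nonneg _).trans h1
  have hzc : z1 (2 * k + 3) ≤ ((2 * k + 3).choose (k + 1) : ℕ) := by
    have := Int.natCast_nonneg (v1 (2 * k + 3) * (k + 2))
    omega
  constructor
  · have : (0 : ℝ) ≤ z1 (2 * k + 3) := by exact_mod_cast h0
    positivity
  · have a1 : (z1 (2 * k + 3) : ℝ) ≤ (2 * k + 3).choose (k + 1) := by exact_mod_cast hzc
    have a2 : (r1 (2 * k + 3) : ℝ) ≤ (2 * k + 3).choose (k + 1) := by exact_mod_cast hr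
    have a3 : (v1 (2 * k + 3) : ℝ) ≤ (2 * k + 3).choose (k + 1) := by exact_mod_cast hv
    linarith

lemma lower_layer_eq (k : ℕ) : ((2 * k + 3).choose k : ℝ)
    = (2 * k + 3).choose (k + 1) * (((k : ℝ) + 1) / (k + 3)) := by
  have h := Nat.choose_succ_right_eq (2 * k + 3) k
  rw [show 2 * k + 3 - k = k + 3 by omega] at h
  have h' : ((2 * k + 3).choose (k + 1) : ℝ) * (k + 1) = (2 * k + 3).choose k * (k + 3) := by
    exact_mod_cast h
  field_simp
  linarith

/-- Closed form of `Pprob` at `n = 2 * k + 3`. -/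
noncomputable def layerProb (k : ℕ) : ℝ :=
  (1 / 2) * (1 + (k + 1) * ((2 : ℝ) ^ (k + 3))⁻¹ - (k + 2) * ((2 : ℝ) ^ (k + 2))⁻¹)

/-- The bracket in `s1hat` at `n = 2 * k + 3`, relative to the size of the central layer. -/
noncomputable def relBracket (k : ℕ) : ℝ :=
  (1 / 2) * (((k : ℝ) + 1) / (k + 3)) *
      (((2 : ℝ) ^ (k + 3))⁻¹ + (1 - ((2 : ℝ) ^ (k + 3))⁻¹) * layerProb k) +
    (1 / 2) * (((2 : ℝ) ^ (k + 2))⁻¹ + (1 - ((2 : ℝ) ^ (k + 2))⁻¹) * (1 - layerProb k))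

lemma central_pos (k : ℕ) : (0 : ℝ) < (2 * k + 3).choose (k + 1) := by
  exact_mod_cast Nat.choose_pos (by omega)

lemma Pprob_eq (k : ℕ) : Pprob (2 * k + 3) = layerProb k := by
  have hC := (central_pos k).ne'
  unfold Pprob layerProb
  rw [show (2 * k + 3 - 3) / 2 = k by omega, show (2 * k + 3 - 1) / 2 = k + 1 by omega,
    show (2 * k + 3 + 3) / 2 = k + 3 by omega, show (2 * k + 3 + 1) / 2 = k + 2 by omega,
    Nat.choose_symm_of_eq_add (show 2 * k + 3 = (k + 2) + (k + 1) by omega), lower_layer_eq]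
  push_cast
  field_simp
  ring

lemma s1hat_eq (k : ℕ) : s1hat (2 * k + 3)
    = (2 ^ (2 * k + 3) : ℝ)⁻¹ * (2 * ((2 * k + 3 : ℝ) * (2 * k + 3).choose (k + 1)))
      * relBracket k := by
  unfold s1hat
  rw [Pprob_eq, show (2 * k + 3 - 3) / 2 = k by omega,
    show (2 * k + 3 + 3) / 2 = k + 3 by omega, show (2 * k + 3 + 1) / 2 = k + 2 by omega,
    Nat.choose_symm_of_eq_add (show 2 * k + 3 = (k + 2) + (k + 1) by omega), lower_layer_eq,
    zpow_sub₀ two_ne_zero, zpow_natCast, zpow_one]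
  unfold relBracket
  push_cast
  ring

lemma ratio_eq (k : ℕ) (hk : 1 ≤ k) :
    expAvgSens (typicalOdd1 (2 * k + 3)) / s1hat (2 * k + 3)
      = (((k : ℝ) + 2) / (2 * k + 3) -
          ((z1 (2 * k + 3) + 3 * r1 (2 * k + 3) + v1 (2 * k + 3) : ℝ)
            / (2 * k + 3).choose (k + 1)) / (2 * k + 3)) / relBracket k := by
  have hC := (central_pos k).ne'
  have hn : (2 * k + 3 : ℝ) ≠ 0 := by positivity
  rw [expAvgSens_typicalOdd1 k hk, s1hat_eq, ← div_div]
  congr 1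
  field_simp

section Asymptotics

open Filter Topology

lemma tendsto_inv_two_pow (a : ℕ) :
    Tendsto (fun k : ℕ => ((2 : ℝ) ^ (k + a))⁻¹) atTop (𝓝 0) :=
  tendsto_inv_atTop_zero.comp
    ((tendsto_pow_atTop_atTop_of_one_lt one_lt_two).comp (tendsto_add_atTop_nat a))

lemma tendsto_mul_inv_two_pow (a b : ℕ) :
    Tendsto (fun k : ℕ => ((k : ℝ) + b) * ((2 : ℝ) ^ (k + a))⁻¹) atTop (𝓝 0) := by
  have h1 := tendsto_self_mul_const_pow_of_lt_one (r := (1 / 2 : ℝ)) (by norm_num)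
    (by norm_num)
  have h2 := (h1.mul_const (((2 : ℝ) ^ a)⁻¹)).add ((tendsto_inv_two_pow a).const_mul (b : ℝ))
  simp only [zero_mul, mul_zero, add_zero] at h2
  refine h2.congr fun k => ?_
  rw [pow_add, one_div, inv_pow, mul_inv]
  ring

lemma tendsto_layerProb : Tendsto layerProb atTop (𝓝 (1 / 2)) := by
  have h := (((tendsto_mul_inv_two_pow 3 1).const_add 1).sub
    (tendsto_mul_inv_two_pow 2 2)).const_mul (1 / 2 : ℝ)
  rw [add_zero, sub_zero, mul_one] at h
  exact h.congr fun k => by simp [layerProb]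

lemma tendsto_natCast_mul_add (c d : ℝ) (hc : 0 < c) :
    Tendsto (fun k : ℕ => c * (k : ℝ) + d) atTop atTop :=
  tendsto_atTop_add_const_right _ _ (tendsto_natCast_atTop_atTop.const_mul_atTop hc)

lemma tendsto_relBracket : Tendsto relBracket atTop (𝓝 (1 / 2)) := by
  have h1 : Tendsto (fun k : ℕ => ((k : ℝ) + 1) / (k + 3)) atTop (𝓝 1) := by
    have h := ((tendsto_natCast_mul_add 1 3 one_pos).const_div_atTop 2).const_sub 1
    rw [sub_zero] at h
    refine h.congr fun k => ?_
    field_simp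
    ring
  have hP := tendsto_layerProb
  have h := ((h1.const_mul (1 / 2 : ℝ)).mul ((tendsto_inv_two_pow 3).add
    (((tendsto_inv_two_pow 3).const_sub 1).mul hP))).add
    (((tendsto_inv_two_pow 2).add (((tendsto_inv_two_pow 2).const_sub 1).mul
      (hP.const_sub 1))).const_mul (1 / 2 : ℝ))
  norm_num only at h
  exact h.congr fun k => by simp [relBracket]

lemma tendsto_numerator :
    Tendsto (fun k : ℕ => ((k : ℝ) + 2) / (2 * k + 3) -
      ((z1 (2 * k + 3) + 3 * r1 (2 * k + 3) + v1 (2 * k + 3) : ℝ)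
        / (2 * k + 3).choose (k + 1)) / (2 * k + 3)) atTop (𝓝 (1 / 2)) := by
  have hn := tendsto_natCast_mul_add 2 3 two_pos
  have h1 : Tendsto (fun k : ℕ => ((k : ℝ) + 2) / (2 * k + 3)) atTop (𝓝 (1 / 2)) := by
    have h := (hn.const_div_atTop (1 / 2)).const_add (1 / 2 : ℝ)
    rw [add_zero] at h
    refine h.congr fun k => ?_
    field_simp
    ring
  have h2 : Tendsto (fun k : ℕ =>
      ((z1 (2 * k + 3) + 3 * r1 (2 * k + 3) + v1 (2 * k + 3) : ℝ)
        / (2 * k + 3).choose (k + 1)) / (2 * k + 3)) atTop (𝓝 0) := by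
    refine squeeze_zero (fun k => ?_) (fun k => ?_) (hn.const_div_atTop 5)
    · exact div_nonneg (div_nonneg (correction_bounds k).1 (Nat.cast_nonneg _)) (by positivity)
    · refine div_le_div_of_nonneg_right ?_ (by positivity)
      rw [div_le_iff₀ (central_pos k)]
      exact (correction_bounds k).2
  simpa using h1.sub h2

lemma tendsto_inf_principal_odd {g : ℕ → ℝ} {l : Filter ℝ}
    (h : Tendsto (fun k => g (2 * k + 3)) atTop l) :
    Tendsto g (atTop ⊓ 𝓟 {n | Odd n}) l := by
  have ht : Tendsto (fun n : ℕ => (n - 3) / 2) atTop atTop :=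
    (Nat.tendsto_div_const_atTop two_ne_zero).comp (tendsto_sub_atTop_nat 3)
  refine ((h.comp ht).mono_left inf_le_left).congr' ?_
  rw [EventuallyEq, eventually_inf_principal]
  filter_upwards [eventually_ge_atTop 3] with n hn hodd
  obtain ⟨j, rfl⟩ := hodd
  simp only [Function.comp_apply]
  congr 1
  omega

end Asymptotics

/-- odd case, first class: `E[s^f] ∼ ŝ_1(n)` as `n → ∞` through odd values,
for `f` uniform on the first class of typical monotone Boolean functions. -/
theorem expected_avgSens_odd_first :
    Filter.Tendsto (fun n : ℕ => expAvgSens (typicalOdd1 n) / s1hat n)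
      (Filter.atTop ⊓ Filter.principal {n : ℕ | Odd n}) (nhds 1) := by
  refine tendsto_inf_principal_odd ?_
  have h := tendsto_numerator.div tendsto_relBracket (by norm_num)
  rw [div_self (by norm_num)] at h
  refine h.congr' ?_
  filter_upwards [Filter.eventually_ge_atTop 1] with k hk
  exact (ratio_eq k hk).symm
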